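/- Let G be a finite group and T a finite set with 2 ≤ |T| < |G|. If G^l_t = G for all t ∈ T, then there exists no multiplicity-free extension R of G by T. In particular, if |G| is prime and 2 ≤ |T| < |G|, then there exists no multiplicity-free extension of G by T at all. -/

import Mathlib

/-- A fusion ring, given by its finite basis `B`, unit, involution (dual) and
structure constants `N a b c` (the coefficient of `c` in `a × b`). -/
structure FusionData (B : Type*) [Fintype B] [DecidableEq B] where
  one : B
  dual : B → B
  N : B → B → B → ℕ
  dual_dual : ∀ a, dual (dual a) = a
  N_one_left : ∀ a c, N one a c = if a = c then 1 else 0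
  N_one_right : ∀ a c, N a one c = if a = c then 1 else 0
  assoc : ∀ a b c d, ∑ e, N a b e * N e c d = ∑ f, N b c f * N a f d
  dual_pair : ∀ a b, N a (dual b) one = if a = b then 1 else 0
  frob : ∀ a b c, N a b c = N (dual a) c b

/-- An extension of a finite group `G` by a finite set `T`: a fusion ring with
basis `G ⊔ T`, unit `1 ∈ G`, whose structure constants restrict to the group
multiplication on `G`. -/
structure GroupExt (G T : Type*) [Group G] [Fintype G] [DecidableEq G]
    [Fintype T] [DecidableEq T] extends FusionData (G ⊕ T) where
  one_def : one = Sum.inl 1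
  mul_def : ∀ g h k : G, N (Sum.inl g) (Sum.inl h) (Sum.inl k) = if g * h = k then 1 else 0
  mul_t : ∀ (g h : G) (t : T), N (Sum.inl g) (Sum.inl h) (Sum.inr t) = 0

namespace FusionData

variable {B : Type*} [Fintype B] [DecidableEq B] (F : FusionData B)

lemma sum_mul_N_one (f : B → ℕ) (c : B) : ∑ e, f e * F.N e c F.one = f (F.dual c) := by
  have h (e : B) : F.N e c F.one = if e = F.dual c then 1 else 0 := by
    rw [← F.dual_pair, F.dual_dual]
  simp [h]

lemma sum_mul_N_one' (f : B → ℕ) (a : B) : ∑ e, f e * F.N a e F.one = f (F.dual a) := by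
  have h (e : B) : F.N a e F.one = if F.dual a = e then 1 else 0 := by
    have h := F.dual_pair a (F.dual e)
    rw [F.dual_dual] at h
    rw [h]
    exact if_congr ⟨fun h => by rw [h, F.dual_dual], fun h => by rw [← h, F.dual_dual]⟩ rfl rfl
  simp [h]

/-- Cyclic symmetry of the structure constants. -/
lemma N_cyclic (a b c : B) : F.N a b (F.dual c) = F.N b c (F.dual a) := by
  rw [← F.sum_mul_N_one (F.N a b), ← F.sum_mul_N_one' (F.N b c), F.assoc]

end FusionData

namespace GroupExt

variable {G T : Type*} [Group G] [Fintype G] [DecidableEq G] [Fintype T] [DecidableEq T]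
  (E : GroupExt G T)

lemma dual_inl (g : G) : E.dual (Sum.inl g) = Sum.inl g⁻¹ := by
  have h := E.dual_pair (Sum.inl g⁻¹) (E.dual (Sum.inl g))
  rw [E.dual_dual, E.one_def, E.mul_def] at h
  by_contra hne
  simp [Ne.symm hne] at h

lemma exists_dual_inr (t : T) : ∃ s, E.dual (Sum.inr t) = Sum.inr s := by
  rcases h : E.dual (Sum.inr t) with g | s
  · have h' := E.dual_dual (Sum.inr t)
    rw [h, E.dual_inl] at h'
    cases h'
  · exact ⟨s, rfl⟩

lemma N_inl_inr_inl (g h : G) (t : T) : E.N (Sum.inl g) (Sum.inr t) (Sum.inl h) = 0 := by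
  rw [E.frob, E.dual_inl, E.mul_t]

lemma N_inv (g : G) (t s : T) : E.N (Sum.inl g⁻¹) (Sum.inr t) (Sum.inr s) =
    E.N (Sum.inl g) (Sum.inr s) (Sum.inr t) := by
  rw [E.frob, E.dual_inl, inv_inv]

lemma N_inl_mul (g h : G) (t s : T) : E.N (Sum.inl (g * h)) (Sum.inr t) (Sum.inr s) =
    ∑ u : T, E.N (Sum.inl h) (Sum.inr t) (Sum.inr u) * E.N (Sum.inl g) (Sum.inr u) (Sum.inr s) := by
  have := E.assoc (Sum.inl g) (Sum.inl h) (Sum.inr t) (Sum.inr s)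
  simpa [Fintype.sum_sum_type, E.mul_def, E.mul_t, E.N_inl_inr_inl] using this

lemma N_inl_one (t s : T) : E.N (Sum.inl 1) (Sum.inr t) (Sum.inr s) = if t = s then 1 else 0 := by
  rw [← E.one_def, E.N_one_left]
  simp

lemma N_inl_mul_ne_zero {g h : G} {t u s : T}
    (h₁ : E.N (Sum.inl h) (Sum.inr t) (Sum.inr u) ≠ 0)
    (h₂ : E.N (Sum.inl g) (Sum.inr u) (Sum.inr s) ≠ 0) :
    E.N (Sum.inl (g * h)) (Sum.inr t) (Sum.inr s) ≠ 0 := by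
  rw [E.N_inl_mul]
  intro h
  have := Finset.sum_eq_zero_iff.mp h u (Finset.mem_univ u)
  exact mul_ne_zero h₁ h₂ this

lemma exists_N_ne_zero (g : G) (t : T) : ∃ u, E.N (Sum.inl g) (Sum.inr t) (Sum.inr u) ≠ 0 := by
  by_contra! h
  have h' := E.N_inl_mul g⁻¹ g t t
  simp [h, E.N_inl_one] at h'

/-- The left stabilizer of `t`. -/
def leftStabilizer (t : T) : Subgroup G where
  carrier := {g | E.N (Sum.inl g) (Sum.inr t) (Sum.inr t) ≠ 0}
  mul_mem' hg hh := E.N_inl_mul_ne_zero hh hg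
  one_mem' := by simp [E.N_inl_one]
  inv_mem' {g} hg := by simpa [E.N_inv] using hg

lemma mem_leftStabilizer {t : T} {g : G} :
    g ∈ E.leftStabilizer t ↔ E.N (Sum.inl g) (Sum.inr t) (Sum.inr t) ≠ 0 := Iff.rfl

lemma leftStabilizer_ne_bot (hlt : Fintype.card T < Fintype.card G) (t : T) :
    E.leftStabilizer t ≠ ⊥ := by
  intro hbot
  choose f hf using fun g : G => E.exists_N_ne_zero g t
  refine hlt.not_ge (Fintype.card_le_of_injective f fun g h hgh => ?_)
  have h₁ : E.N (Sum.inl h⁻¹) (Sum.inr (f g)) (Sum.inr t) ≠ 0 := by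
    rw [E.N_inv, hgh]
    exact hf h
  have h₂ : h⁻¹ * g ∈ E.leftStabilizer t := E.N_inl_mul_ne_zero (hf g) h₁
  rw [hbot, Subgroup.mem_bot] at h₂
  exact (inv_mul_eq_one.mp h₂).symm

lemma N_eq_ite_of_mem_leftStabilizer (hE : ∀ a b c : G ⊕ T, E.N a b c ≤ 1) {g : G} {t : T}
    (hg : g ∈ E.leftStabilizer t) (s : T) :
    E.N (Sum.inl g) (Sum.inr t) (Sum.inr s) = if t = s then 1 else 0 := by
  split_ifs with hts
  · subst hts
    exact le_antisymm (hE _ _ _) (Nat.one_le_iff_ne_zero.mpr hg)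
  · by_contra hne
    have h := E.N_inl_mul_ne_zero ((E.leftStabilizer t).inv_mem hg) hne
    rw [mul_inv_cancel, E.N_inl_one, if_neg hts] at h
    exact h rfl

/-- If all left stabilizers are `G`, then `t × s̄` contains `g ∈ G` exactly when `t = s`. -/
lemma N_inr_dual_inl (hE : ∀ a b c : G ⊕ T, E.N a b c ≤ 1)
    (hstab : ∀ t, E.leftStabilizer t = ⊤) (t s : T) (g : G) :
    E.N (Sum.inr t) (E.dual (Sum.inr s)) (Sum.inl g) = if t = s then 1 else 0 := by
  have h := E.N_cyclic (Sum.inl g⁻¹) (Sum.inr t) (E.dual (Sum.inr s))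
  rw [E.dual_dual, E.dual_inl, inv_inv] at h
  rw [← h, E.N_eq_ite_of_mem_leftStabilizer hE (by simp [hstab])]

lemma card_le_of_leftStabilizer_eq_top (hE : ∀ a b c : G ⊕ T, E.N a b c ≤ 1)
    (hstab : ∀ t, E.leftStabilizer t = ⊤) (hT : 1 < Fintype.card T) :
    Fintype.card G ≤ Fintype.card T := by
  obtain ⟨t, s, hts⟩ := Fintype.one_lt_card_iff.mp hT
  have h := E.assoc (Sum.inr t) (E.dual (Sum.inr t)) (Sum.inr s) (Sum.inr s)
  have hzero (g : G) : E.N (E.dual (Sum.inr t)) (Sum.inr s) (Sum.inl g) = 0 := by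
    obtain ⟨t', ht'⟩ := E.exists_dual_inr t
    obtain ⟨s', hs'⟩ := E.exists_dual_inr s
    have hs : Sum.inr s = E.dual (Sum.inr s') := by rw [← hs', E.dual_dual]
    rw [ht', hs, E.N_inr_dual_inl hE hstab, if_neg]
    rintro rfl
    exact hts (Sum.inr_injective (by rw [← E.dual_dual (Sum.inr t), ht', hs]))
  simp only [Fintype.sum_sum_type, hzero, E.N_inr_dual_inl hE hstab,
    fun g : G => E.N_eq_ite_of_mem_leftStabilizer hE (by simp [hstab] : g ∈ E.leftStabilizer s) s,
    if_true, mul_one, zero_mul, Finset.sum_const_zero, zero_add, Finset.sum_const,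
    Finset.card_univ, smul_eq_mul] at h
  calc Fintype.card G ≤ _ := Nat.le_add_right _ _
    _ = _ := h
    _ ≤ ∑ _u : T, 1 := Finset.sum_le_sum fun u _ => mul_le_one' (hE _ _ _) (hE _ _ _)
    _ = Fintype.card T := by simp

end GroupExt

/-- If `2 ≤ |T| < |G|` then there is no multiplicity-free extension
of `G` by `T` in which `G^l_t = G` for all `t ∈ T`; in particular if `|G|` is
prime there is no multiplicity-free extension of `G` by `T` at all. -/
theorem no_multfree_extension_full_stab {G T : Type*} [Group G] [Fintype G] [DecidableEq G]
    [Fintype T] [DecidableEq T] [Nonempty T]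
    (h2 : 2 ≤ Fintype.card T) (hlt : Fintype.card T < Fintype.card G) :
    (¬ ∃ E : GroupExt G T,
        (∀ a b c : G ⊕ T, E.N a b c ≤ 1) ∧
        (∀ (g : G) (t : T), E.N (Sum.inl g) (Sum.inr t) (Sum.inr t) ≠ 0)) ∧
    ((Fintype.card G).Prime →
      ¬ ∃ E : GroupExt G T, ∀ a b c : G ⊕ T, E.N a b c ≤ 1) := by
  refine ⟨?_, fun hp => ?_⟩
  · rintro ⟨E, hE, hstab⟩
    refine hlt.not_ge (E.card_le_of_leftStabilizer_eq_top hE (fun t => ?_) h2)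
    exact (Subgroup.eq_top_iff' _).mpr fun g => hstab g t
  · rintro ⟨E, hE⟩
    refine hlt.not_ge (E.card_le_of_leftStabilizer_eq_top hE (fun t => ?_) h2)
    have : Fact (Nat.card G).Prime := ⟨by rwa [Nat.card_eq_fintype_card]⟩
    exact ((E.leftStabilizer t).eq_bot_or_eq_top_of_prime_card).resolve_left
      (E.leftStabilizer_ne_bot hlt t)
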